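/- Let S = ((X,d),(f_i)_{i∈I}) be an IFS that has an attractor A_S, and suppose there exists a continuous surjection π : Λ(I) → A_S with f_i ∘ π = π ∘ τ_i for all i ∈ I, and suppose lim_{n→∞} max_{ω∈I^n} diam(f_ω(A_S)) = 0. Then S is locally uniformly point fibred: writing b_ω for the unique element of ⋂_{n≥1} f_{[ω]_n}(A_S), for every x ∈ X and every η > 0, lim_{n→∞} sup_{ω∈Λ(I)} sup_{y∈closure(B(x,η))} d(f_{[ω]_n}(y), b_ω) = 0. -/

import Mathlib

open Metric Set Filter Bornology

/-- Composition of the maps of an IFS along a finite word: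
`wordComp f [i₁,…,iₙ] = f i₁ ∘ … ∘ f iₙ`. -/
def wordComp {I X : Type*} (f : I → X → X) : List I → X → X
  | [] => id
  | i :: l => f i ∘ wordComp f l

/-- The prefix `[ω]_n` of length `n` of an infinite word `ω ∈ Λ(I) = I^ℕ`. -/
def prefixList {I : Type*} (ω : ℕ → I) (n : ℕ) : List I :=
  List.ofFn fun k : Fin n => ω k

/-- The fractal operator of an IFS: `F_S(B)` is the closure of `⋃ i, f_i(B)`. -/
def fractalOp {I X : Type*} [MetricSpace X] (f : I → X → X) (B : Set X) : Set X :=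
  closure (⋃ i, f i '' B)

/-- Prepending a letter to an infinite word: `τ_i(ω) = iω`. -/
def prepend {I : Type*} (i : I) (ω : ℕ → I) : ℕ → I
  | 0 => i
  | n + 1 => ω n

section IFS

variable {I X : Type*}

theorem wordComp_append (f : I → X → X) (u v : List I) :
    wordComp f (u ++ v) = wordComp f u ∘ wordComp f v := by
  induction u with
  | nil => rfl
  | cons i u ih => simp [wordComp, ih, Function.comp_assoc]

theorem continuous_wordComp [TopologicalSpace X] {f : I → X → X} (hf : ∀ i, Continuous (f i))
    (l : List I) : Continuous (wordComp f l) := by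
  induction l with
  | nil => exact continuous_id
  | cons i l ih => exact (hf i).comp ih

theorem length_prefixList (ω : ℕ → I) (n : ℕ) : (prefixList ω n).length = n := by
  simp [prefixList]

theorem prefixList_succ (ω : ℕ → I) (n : ℕ) :
    prefixList ω (n + 1) = ω 0 :: prefixList (fun k => ω (k + 1)) n := by
  simp [prefixList, List.ofFn_succ]

theorem prefixList_add (ω : ℕ → I) (m n : ℕ) :
    prefixList ω (m + n) = prefixList ω m ++ prefixList (fun k => ω (m + k)) n := by
  simp [prefixList, List.ofFn_add]

theorem prepend_zero_succ (ω : ℕ → I) : prepend (ω 0) (fun k => ω (k + 1)) = ω := by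
  funext k
  cases k <;> rfl

theorem exists_wordComp_prefixList_eq {f : I → X → X} {π : (ℕ → I) → X}
    (hequiv : ∀ i, f i ∘ π = π ∘ prepend i) (ω : ℕ → I) (n : ℕ) :
    ∃ ω', wordComp f (prefixList ω n) (π ω') = π ω := by
  induction n generalizing ω with
  | zero => exact ⟨ω, by simp [prefixList, wordComp]⟩
  | succ n ih =>
    obtain ⟨ω', h⟩ := ih fun k => ω (k + 1)
    refine ⟨ω', ?_⟩
    rw [prefixList_succ, wordComp, Function.comp_apply, h, ← Function.comp_apply (f := f _),
      hequiv, Function.comp_apply, prepend_zero_succ]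

variable [MetricSpace X]

theorem wordComp_mem_iterate_fractalOp (f : I → X → X) {B : Set X} {y : X} (hy : y ∈ B)
    (l : List I) : wordComp f l y ∈ (fractalOp f)^[l.length] B := by
  induction l with
  | nil => exact hy
  | cons i l ih =>
    rw [List.length_cons, Function.iterate_succ_apply']
    exact subset_closure (mem_iUnion.2 ⟨i, mem_image_of_mem _ ih⟩)

theorem isBounded_iterate_fractalOp [Finite I] {f : I → X → X}
    (hbdd : ∀ i (B : Set X), IsBounded B → IsBounded (f i '' B)) {B : Set X} (hB : IsBounded B)
    (n : ℕ) : IsBounded ((fractalOp f)^[n] B) := by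
  induction n with
  | zero => exact hB
  | succ n ih =>
    rw [Function.iterate_succ_apply']
    exact (isBounded_iUnion.2 fun i => hbdd i _ ih).closure

/-- Orbits of a bounded set under words of length `n` approach the attractor uniformly. -/
theorem eventually_exists_dist_wordComp_lt [Finite I] {f : I → X → X}
    (hbdd : ∀ i (B : Set X), IsBounded B → IsBounded (f i '' B)) {A B : Set X}
    (hAne : A.Nonempty) (hAbd : IsBounded A) (hB : IsBounded B)
    (hlim : Tendsto (fun n : ℕ => hausdorffDist ((fractalOp f)^[n] B) A) atTop (nhds 0))
    {δ : ℝ} (hδ : 0 < δ) :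
    ∀ᶠ n in atTop, ∀ l : List I, l.length = n → ∀ y ∈ B, ∃ a ∈ A, dist (wordComp f l y) a < δ := by
  filter_upwards [hlim.eventually_lt_const hδ] with n hn l hl y hy
  have hmem := wordComp_mem_iterate_fractalOp f hy l
  rw [hl] at hmem
  exact exists_dist_lt_of_hausdorffDist_lt hmem hn
    (hausdorffEDist_ne_top_of_nonempty_of_bounded ⟨_, hmem⟩ hAne
      (isBounded_iterate_fractalOp hbdd hB n) hAbd)

theorem dist_le_iSup_diam_wordComp [Finite I] {f : I → X → X} (hf : ∀ i, Continuous (f i))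
    {A : Set X} (hA : IsCompact A) (ω : ℕ → I) (n : ℕ) {p q : X}
    (hp : p ∈ wordComp f (prefixList ω n) '' A) (hq : q ∈ wordComp f (prefixList ω n) '' A) :
    dist p q ≤ ⨆ ω : Fin n → I, diam (wordComp f (List.ofFn ω) '' A) :=
  (dist_le_diam_of_mem (hA.image (continuous_wordComp hf _)).isBounded hp hq).trans
    (le_ciSup (f := fun ω : Fin n → I => diam (wordComp f (List.ofFn ω) '' A))
      (finite_range _).bddAbove fun k => ω k)

end IFS

/-- **Theorem 4.1, 5 ⇒ 2.** Suppose the IFS `S` has an attractor `A_S`, there is a continuous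
surjection `π : Λ(I) → A_S` with `f_i ∘ π = π ∘ τ_i` for all `i`, and
`max_{ω ∈ Iⁿ} diam (f_ω(A_S)) → 0`. Then `S` is locally uniformly point fibred: writing `b_ω`
for the unique element of `⋂_{n≥1} f_{[ω]_n}(A_S)`, for every `x ∈ X` and `η > 0`,
`sup_{ω ∈ Λ(I)} sup_{y ∈ closure (B(x,η))} d(f_{[ω]_n}(y), b_ω) → 0`. -/
theorem locally_uniformly_point_fibred_of_attractor {X I : Type*} [MetricSpace X]
    [CompleteSpace X] [Finite I] [Nonempty I] [TopologicalSpace I] [DiscreteTopology I]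
    (f : I → X → X)
    (hcont : ∀ i, Continuous (f i))
    (hbdd : ∀ i (B : Set X), IsBounded B → IsBounded (f i '' B))
    (A : Set X) (hAne : A.Nonempty) (hAbd : IsBounded A) (hAcl : IsClosed A)
    (hfix : fractalOp f A = A)
    (hattr : ∀ B : Set X, B.Nonempty → IsBounded B → IsClosed B →
      Tendsto (fun n : ℕ => hausdorffDist ((fractalOp f)^[n] B) A) atTop (nhds 0))
    (π : (ℕ → I) → X) (hπc : Continuous π) (hπr : Set.range π = A)
    (hequiv : ∀ i : I, f i ∘ π = π ∘ prepend i)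
    (hdiam : Tendsto (fun n : ℕ => ⨆ ω : Fin n → I, diam (wordComp f (List.ofFn ω) '' A))
      atTop (nhds 0)) :
    ∃ b : (ℕ → I) → X,
      (∀ ω : ℕ → I, (⋂ (n : ℕ) (_ : 1 ≤ n), wordComp f (prefixList ω n) '' A) = {b ω}) ∧
      ∀ (x : X) (η : ℝ), 0 < η →
        Tendsto
          (fun n : ℕ => ⨆ (ω : ℕ → I) (y : X) (_ : y ∈ closure (ball x η)),
            dist (wordComp f (prefixList ω n) y) (b ω))
          atTop (nhds 0) := by
  have hAc : IsCompact A := hπr ▸ isCompact_range hπc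
  have hmem : ∀ ω n, π ω ∈ wordComp f (prefixList ω n) '' A := fun ω n => by
    obtain ⟨ω', h⟩ := exists_wordComp_prefixList_eq hequiv ω n
    exact ⟨π ω', hπr ▸ mem_range_self ω', h⟩
  refine ⟨π, fun ω => ?_, fun x η hη => ?_⟩
  · refine Subset.antisymm (fun p hp => ?_)
      (singleton_subset_iff.2 (mem_iInter₂.2 fun n _ => hmem ω n))
    refine dist_le_zero.1 (ge_of_tendsto hdiam ?_)
    filter_upwards [eventually_ge_atTop 1] with n hn
    exact dist_le_iSup_diam_wordComp hcont hAc ω n (mem_iInter₂.1 hp n hn) (hmem ω n)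
  · have hB : IsBounded (closure (ball x η)) := isBounded_ball.closure
    have hlim := hattr _ ⟨x, subset_closure (mem_ball_self hη)⟩ hB isClosed_closure
    rw [Metric.tendsto_atTop]
    intro ε hε
    obtain ⟨m, hm⟩ := (hdiam.eventually_lt_const (by positivity : 0 < ε / 4)).exists
    have hunif : ∀ᶠ z : X × X in uniformity X, ∀ v : Fin m → I, z.1 ∈ A →
        dist (wordComp f (List.ofFn v) z.1) (wordComp f (List.ofFn v) z.2) < ε / 4 :=
      eventually_all.2 fun v => hAc.uniformContinuousAt_of_continuousAt _
        (fun a _ => (continuous_wordComp hcont _).continuousAt)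
        (dist_mem_uniformity (by positivity))
    obtain ⟨δ, hδ, hδ'⟩ := Metric.mem_uniformity_dist.1 hunif
    obtain ⟨N, hN⟩ := eventually_atTop.1
      (eventually_exists_dist_wordComp_lt hbdd hAne hAbd hB hlim hδ)
    refine ⟨m + N, fun n hn => ?_⟩
    obtain ⟨k, rfl⟩ := Nat.exists_eq_add_of_le (le_of_add_le_left hn)
    have key : ∀ ω : ℕ → I, ∀ y ∈ closure (ball x η),
        dist (wordComp f (prefixList ω (m + k)) y) (π ω) ≤ ε / 2 := fun ω y hy => by
      obtain ⟨a, ha, hya⟩ := hN k (by omega) _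
        (length_prefixList (fun j => ω (m + j)) k) y hy
      rw [prefixList_add, wordComp_append, Function.comp_apply]
      have h₁ : dist (wordComp f (prefixList ω m) a) (wordComp f (prefixList ω m) _) < ε / 4 :=
        hδ' (dist_comm a _ ▸ hya) (fun j => ω j) ha
      have h₂ := dist_le_iSup_diam_wordComp hcont hAc ω m (mem_image_of_mem _ ha) (hmem ω m)
      have h₃ := dist_triangle_left (wordComp f (prefixList ω m)
        (wordComp f (prefixList (fun j => ω (m + j)) k) y)) (π ω) (wordComp f (prefixList ω m) a)
      linarith
    rw [Real.dist_0_eq_abs, abs_of_nonneg (Real.iSup_nonneg fun ω => Real.iSup_nonneg fun y =>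
      Real.iSup_nonneg fun _ => dist_nonneg)]
    refine lt_of_le_of_lt ?_ (half_lt_self hε)
    have hε' : 0 ≤ ε / 2 := by positivity
    exact Real.iSup_le (fun ω => Real.iSup_le (fun y => Real.iSup_le (key ω y) hε') hε') hε'
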